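/- Let T > 0 and μ, σ, ν > 0, and let K ⊂ ℝ³ be compact. Let H, u, J, f : [0,T] × ℝ³ → ℝ³ and p : [0,T] × ℝ³ → ℝ be smooth functions whose spatial supports are contained in K for every t ∈ [0,T], and suppose they satisfy the incompressible MHD system at every point of [0,T] × ℝ³: (i) μ ∂ₜH + σ⁻¹ ∇×(∇×H) − μ ∇×(u×H) = σ⁻¹ ∇×J; (ii) ∂ₜu + (u·∇)u − νΔu + ∇p = f − μ H×(∇×H); (iii) ∇·u = 0. Then for every t ∈ [0,T] the energy identity holds: d/dt [ (μ/2)∫_{ℝ³}|H(t,x)|² dx + (1/2)∫_{ℝ³}|u(t,x)|² dx ] + σ⁻¹ ∫_{ℝ³}|∇×H(t,x)|² dx + ν ∫_{ℝ³}|∇u(t,x)|² dx = σ⁻¹ ∫_{ℝ³} J(t,x)·(∇×H)(t,x) dx + ∫_{ℝ³} f(t,x)·u(t,x) dx, where |∇u|² := Σ_{i,j} (∂_j u_i)² denotes the squared Frobenius norm of the spatial velocity gradient. -/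

import Mathlib

open MeasureTheory

/-- `∂ⱼ F` at `x`: the `j`-th partial derivative of a vector field `F : ℝ³ → ℝ³`. -/
noncomputable def pd3 (F : (Fin 3 → ℝ) → (Fin 3 → ℝ)) (j : Fin 3)
    (x : Fin 3 → ℝ) : Fin 3 → ℝ :=
  fderiv ℝ F x (Pi.single j 1)

/-- `∂ⱼ g` at `x` for a scalar function `g : ℝ³ → ℝ`. -/
noncomputable def pds3 (g : (Fin 3 → ℝ) → ℝ) (j : Fin 3) (x : Fin 3 → ℝ) : ℝ :=
  fderiv ℝ g x (Pi.single j 1)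

/-- The curl `∇×F = (∂₂F₃ − ∂₃F₂, ∂₃F₁ − ∂₁F₃, ∂₁F₂ − ∂₂F₁)` (0-indexed). -/
noncomputable def curl3 (F : (Fin 3 → ℝ) → (Fin 3 → ℝ)) (x : Fin 3 → ℝ) : Fin 3 → ℝ :=
  ![pd3 F 1 x 2 - pd3 F 2 x 1,
    pd3 F 2 x 0 - pd3 F 0 x 2,
    pd3 F 0 x 1 - pd3 F 1 x 0]

/-- The divergence `∇·F = ∂₁F₁ + ∂₂F₂ + ∂₃F₃`. -/
noncomputable def div3 (F : (Fin 3 → ℝ) → (Fin 3 → ℝ)) (x : Fin 3 → ℝ) : ℝ :=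
  ∑ j, pd3 F j x j

/-- The componentwise Laplacian `(ΔF)_i = Σ_j ∂_j ∂_j F_i`. -/
noncomputable def lap3 (F : (Fin 3 → ℝ) → (Fin 3 → ℝ)) (x : Fin 3 → ℝ) (i : Fin 3) : ℝ :=
  ∑ j, pd3 (fun y => pd3 F j y) j x i

/-- The pointwise cross product in `ℝ³`. -/
def cross3 (a b : Fin 3 → ℝ) : Fin 3 → ℝ :=
  ![a 1 * b 2 - a 2 * b 1,
    a 2 * b 0 - a 0 * b 2,
    a 0 * b 1 - a 1 * b 0]

open Set

section PartialDerivatives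

variable {F G : (Fin 3 → ℝ) → (Fin 3 → ℝ)} {a b : (Fin 3 → ℝ) → ℝ} {x : Fin 3 → ℝ}

lemma pd3_apply (hF : DifferentiableAt ℝ F x) (j i : Fin 3) :
    pd3 F j x i = pds3 (fun y => F y i) j x := by
  unfold pd3 pds3
  rw [(hasFDerivAt_pi'.1 hF.hasFDerivAt i).fderiv]
  rfl

lemma pds3_add (ha : DifferentiableAt ℝ a x) (hb : DifferentiableAt ℝ b x) (j : Fin 3) :
    pds3 (fun y => a y + b y) j x = pds3 a j x + pds3 b j x := by
  simp [pds3, fderiv_fun_add ha hb]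

lemma pds3_sub (ha : DifferentiableAt ℝ a x) (hb : DifferentiableAt ℝ b x) (j : Fin 3) :
    pds3 (fun y => a y - b y) j x = pds3 a j x - pds3 b j x := by
  simp [pds3, fderiv_fun_sub ha hb]

lemma pds3_mul (ha : DifferentiableAt ℝ a x) (hb : DifferentiableAt ℝ b x) (j : Fin 3) :
    pds3 (fun y => a y * b y) j x = a x * pds3 b j x + b x * pds3 a j x := by
  simp [pds3, fderiv_fun_mul ha hb]

lemma div3_eq (hF : DifferentiableAt ℝ F x) :
    div3 F x = ∑ j, pds3 (fun y => F y j) j x :=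
  Finset.sum_congr rfl fun j _ => pd3_apply hF j j

lemma differentiable_cross3 (hF : Differentiable ℝ F) (hG : Differentiable ℝ G) :
    Differentiable ℝ (fun y => cross3 (F y) (G y)) := by
  rw [differentiable_pi] at *
  intro i
  fin_cases i <;> simp [cross3] <;> fun_prop

/-- `∇·(F×G) = G·(∇×F) − F·(∇×G)`. -/
lemma div3_cross3 (hF : Differentiable ℝ F) (hG : Differentiable ℝ G) (x : Fin 3 → ℝ) :
    div3 (fun y => cross3 (F y) (G y)) x
      = (∑ i, G x i * curl3 F x i) - ∑ i, F x i * curl3 G x i := by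
  rw [div3_eq (differentiable_cross3 hF hG x)]
  have hF' : ∀ i, DifferentiableAt ℝ (fun y => F y i) x := fun i => by fun_prop
  have hG' : ∀ i, DifferentiableAt ℝ (fun y => G y i) x := fun i => by fun_prop
  have key : ∀ i k j, pds3 (fun y => F y i * G y k - F y k * G y i) j x
      = F x i * pd3 G j x k + G x k * pd3 F j x i
        - (F x k * pd3 G j x i + G x i * pd3 F j x k) := fun i k j => by
    rw [pds3_sub ((hF' i).fun_mul (hG' k)) ((hF' k).fun_mul (hG' i)), pds3_mul (hF' i) (hG' k),
      pds3_mul (hF' k) (hG' i)]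
    simp only [pd3_apply (hF x), pd3_apply (hG x)]
  simp only [Fin.sum_univ_three, cross3, curl3, Matrix.cons_val]
  rw [key, key, key]
  ring

/-- `∇·(aF) = F·∇a + a ∇·F`. -/
lemma div3_mul (ha : Differentiable ℝ a) (hF : Differentiable ℝ F) (x : Fin 3 → ℝ) :
    div3 (fun y i => a y * F y i) x = (∑ i, F x i * pds3 a i x) + a x * div3 F x := by
  have hF' : ∀ i, DifferentiableAt ℝ (fun y => F y i) x := fun i => by fun_prop
  rw [div3_eq (differentiable_pi.2 (fun i => by fun_prop) x), div3_eq (hF x), Finset.mul_sum,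
    ← Finset.sum_add_distrib]
  refine Finset.sum_congr rfl fun j _ => ?_
  rw [pds3_mul (ha x) (hF' j)]
  ring

lemma pds3_sum_sq (hF : Differentiable ℝ F) (j : Fin 3) (x : Fin 3 → ℝ) :
    pds3 (fun y => ∑ i, F y i ^ 2) j x = 2 * ∑ i, F x i * pd3 F j x i := by
  have hF' : ∀ i, DifferentiableAt ℝ (fun y => F y i) x := fun i => by fun_prop
  simp only [Fin.sum_univ_three, sq, pd3_apply (hF x)]
  rw [pds3_add (((hF' 0).fun_mul (hF' 0)).fun_add ((hF' 1).fun_mul (hF' 1))) ((hF' 2).fun_mul (hF' 2)),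
    pds3_add ((hF' 0).fun_mul (hF' 0)) ((hF' 1).fun_mul (hF' 1)),
    pds3_mul (hF' 0) (hF' 0), pds3_mul (hF' 1) (hF' 1), pds3_mul (hF' 2) (hF' 2)]
  ring

lemma contDiff_pd3 (hF : ContDiff ℝ (⊤ : ℕ∞) F) (j : Fin 3) :
    ContDiff ℝ (⊤ : ℕ∞) (fun y => pd3 F j y) :=
  (hF.fderiv_right (m := (⊤ : ℕ∞)) (by simp)).clm_apply contDiff_const

lemma contDiff_cross3 {n : WithTop ℕ∞} (hF : ContDiff ℝ n F) (hG : ContDiff ℝ n G) :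
    ContDiff ℝ n (fun y => cross3 (F y) (G y)) := by
  rw [contDiff_pi] at *
  intro i
  fin_cases i <;> simp [cross3] <;> fun_prop

lemma contDiff_curl3 (hF : ContDiff ℝ (⊤ : ℕ∞) F) :
    ContDiff ℝ (⊤ : ℕ∞) (fun y => curl3 F y) := by
  have h : ∀ j i, ContDiff ℝ (⊤ : ℕ∞) (fun y => pd3 F j y i) :=
    fun j i => contDiff_pi.1 (contDiff_pd3 hF j) i
  rw [contDiff_pi]
  intro i
  fin_cases i <;> simp [curl3] <;> exact (h _ _).sub (h _ _)

/-- The divergence of `Σᵢ Fᵢ ∇Fᵢ` is `F·ΔF + |∇F|²`. -/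
lemma div3_sum_mul_pd3 (hF : ContDiff ℝ (⊤ : ℕ∞) F) (x : Fin 3 → ℝ) :
    div3 (fun y j => ∑ i, F y i * pd3 F j y i) x
      = (∑ i, F x i * lap3 F x i) + ∑ i, ∑ j, pd3 F j x i ^ 2 := by
  have hd : Differentiable ℝ F := hF.differentiable (by simp)
  have hF' : ∀ i, DifferentiableAt ℝ (fun y => F y i) x := fun i => by fun_prop
  have hp : ∀ j, Differentiable ℝ (fun y => pd3 F j y) :=
    fun j => (contDiff_pd3 hF j).differentiable (by simp)
  have hp' : ∀ j i, Differentiable ℝ (fun y => pd3 F j y i) :=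
    fun j i => differentiable_pi.1 (hp j) i
  have hm : ∀ j i, DifferentiableAt ℝ (fun y => F y i * pd3 F j y i) x :=
    fun j i => (hF' i).mul (hp' j i x)
  rw [div3_eq (differentiable_pi.2 (fun i => by fun_prop) x)]
  have key : ∀ j, pds3 (fun y => ∑ i, F y i * pd3 F j y i) j x
      = ∑ i, (F x i * pd3 (fun y => pd3 F j y) j x i + pd3 F j x i ^ 2) := fun j => by
    simp only [Fin.sum_univ_three]
    rw [pds3_add ((hm j 0).fun_add (hm j 1)) (hm j 2), pds3_add (hm j 0) (hm j 1)]
    simp only [pds3_mul (hF' _) (hp' j _ x), pd3_apply (hp j x), ← pd3_apply (hd x)]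
    ring
  rw [Finset.sum_congr rfl fun j _ => key j]
  simp only [lap3, Fin.sum_univ_three]
  ring

variable {K : Set (Fin 3 → ℝ)}

lemma pd3_eq_zero (hK : IsClosed K) (hF : ∀ y ∉ K, F y = 0) (j : Fin 3) (hx : x ∉ K) :
    pd3 F j x = 0 := by
  have h : F =ᶠ[nhds x] fun _ => 0 :=
    Filter.eventually_of_mem (hK.isOpen_compl.mem_nhds hx) hF
  simp [pd3, h.fderiv_eq]

lemma curl3_eq_zero (hK : IsClosed K) (hF : ∀ y ∉ K, F y = 0) (hx : x ∉ K) :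
    curl3 F x = 0 := by
  funext i
  fin_cases i <;> simp [curl3, pd3_eq_zero hK hF _ hx]

lemma Continuous.integrable_of_eq_zero (ha : Continuous a) (hK : IsCompact K)
    (h : ∀ y ∉ K, a y = 0) : Integrable a :=
  ha.integrable_of_hasCompactSupport (HasCompactSupport.intro hK h)

lemma integrable_div3 (hK : IsCompact K) (hF : ContDiff ℝ 1 F) (h : ∀ y ∉ K, F y = 0) :
    Integrable (div3 F) := by
  refine Continuous.integrable_of_eq_zero (K := K) ?_ hK fun y hy => ?_
  · refine continuous_finsetSum _ fun j _ => ?_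
    exact (continuous_apply j).comp ((hF.continuous_fderiv (by simp)).clm_apply continuous_const)
  · simp [div3, pd3_eq_zero hK.isClosed h _ hy]

/-- The divergence theorem for compactly supported fields. -/
lemma integral_div3 (hK : IsCompact K) (hF : ContDiff ℝ 1 F) (h : ∀ y ∉ K, F y = 0) :
    ∫ y, div3 F y = 0 := by
  have hd : Differentiable ℝ F := hF.differentiable (by simp)
  have hc : ∀ j, Continuous (fun y => pd3 F j y) := fun j =>
    (hF.continuous_fderiv (by simp)).clm_apply continuous_const
  have hi : ∀ j, Integrable (fun y => pd3 F j y j) := fun j =>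
    Continuous.integrable_of_eq_zero ((continuous_apply j).comp (hc j)) hK
      fun y hy => by simp [pd3_eq_zero hK.isClosed h _ hy]
  unfold div3
  rw [integral_finsetSum _ fun j _ => hi j]
  refine Finset.sum_eq_zero fun j _ => ?_
  have hj : Integrable (fun y => F y j) :=
    Continuous.integrable_of_eq_zero ((continuous_apply j).comp hF.continuous) hK
      fun y hy => by simp [h y hy]
  have := hi j
  simp only [pd3_apply (hd _)] at this ⊢
  have hz := integral_mul_fderiv_eq_neg_fderiv_mul_of_integrable (μ := volume)
    (f := fun _ : Fin 3 → ℝ => (1 : ℝ)) (g := fun y => F y j) (v := Pi.single j 1)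
    (by simp) (by simpa [pds3] using this) (by simpa using hj)
    (fun _ _ => by fun_prop) (fun _ _ => by fun_prop)
  simpa [pds3] using hz

end PartialDerivatives

/-- Differentiation under the integral sign for `C¹` functions with spatial support in a fixed
compact set. -/
lemma hasDerivAt_integral_of_contDiff {g : ℝ → (Fin 3 → ℝ) → ℝ} {K : Set (Fin 3 → ℝ)}
    (hK : IsCompact K) (hg : ContDiff ℝ 1 (fun q : ℝ × (Fin 3 → ℝ) => g q.1 q.2))
    (h : ∀ t, ∀ x ∉ K, g t x = 0) (t : ℝ) :
    HasDerivAt (fun s => ∫ x, g s x) (∫ x, deriv (fun s => g s x) t) t := by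
  have hder : ∀ s x, HasDerivAt (fun s => g s x)
      (fderiv ℝ (fun q : ℝ × (Fin 3 → ℝ) => g q.1 q.2) (s, x) (1, 0)) s := fun s x => by
    have h1 := (hg.differentiable (by simp) (s, x)).hasFDerivAt
    have h2 : HasDerivAt (fun s : ℝ => (s, x)) ((1 : ℝ), (0 : Fin 3 → ℝ)) s :=
      (hasDerivAt_id s).prodMk (hasDerivAt_const s x)
    exact h1.comp_hasDerivAt s h2
  have hcont : Continuous (fun q : ℝ × (Fin 3 → ℝ) =>
      fderiv ℝ (fun q : ℝ × (Fin 3 → ℝ) => g q.1 q.2) q (1, 0)) :=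
    (hg.continuous_fderiv (by simp)).clm_apply continuous_const
  have hslice : ∀ s, Continuous (g s) := fun s => hg.continuous.comp (by fun_prop : Continuous fun x : Fin 3 → ℝ => (s, x))
  obtain ⟨C, hC⟩ := ((isCompact_closedBall t 1).prod hK).exists_bound_of_continuousOn
    hcont.continuousOn
  have hdcont : Continuous fun x => deriv (fun s => g s x) t := by
    simp only [(hder _ _).deriv]
    exact hcont.comp (by fun_prop : Continuous fun x : Fin 3 → ℝ => (t, x))
  refine (hasDerivAt_integral_of_dominated_loc_of_deriv_le
    (F' := fun s x => deriv (fun s => g s x) s) (bound := K.indicator fun _ => C)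
    (Metric.closedBall_mem_nhds t one_pos)
    (Filter.Eventually.of_forall fun s => (hslice s).aestronglyMeasurable)
    ((hslice t).integrable_of_eq_zero hK (h t)) hdcont.aestronglyMeasurable
    (Filter.Eventually.of_forall fun x s hs => ?_) ?_
    (Filter.Eventually.of_forall fun x s _ => (hder s x).differentiableAt.hasDerivAt)).2
  · by_cases hx : x ∈ K
    · rw [indicator_of_mem hx, (hder s x).deriv]
      exact hC (s, x) ⟨hs, hx⟩
    · simp [hx, h _ x hx]
  · rw [integrable_indicator_iff hK.measurableSet]
    exact integrableOn_const hK.measure_lt_top.ne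

/-- Time derivative of `∫ |F|²`. -/
lemma hasDerivAt_integral_sum_sq {F : ℝ → (Fin 3 → ℝ) → (Fin 3 → ℝ)} {K : Set (Fin 3 → ℝ)}
    (hK : IsCompact K) (hF : ContDiff ℝ (⊤ : ℕ∞) (fun q : ℝ × (Fin 3 → ℝ) => F q.1 q.2))
    (h : ∀ t, ∀ x ∉ K, F t x = 0) (t : ℝ) :
    HasDerivAt (fun s => ∫ x, ∑ i, F s x i ^ 2)
      (∫ x, 2 * ∑ i, F t x i * deriv (fun s => F s x i) t) t := by
  have hF' : ∀ i, ContDiff ℝ (⊤ : ℕ∞) (fun q : ℝ × (Fin 3 → ℝ) => F q.1 q.2 i) :=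
    contDiff_pi.1 hF
  have hd : ∀ x i, Differentiable ℝ (fun s => F s x i) := fun x i =>
    ((hF' i).differentiable (by simp)).comp
      (g := fun q : ℝ × (Fin 3 → ℝ) => F q.1 q.2 i) (f := fun s => (s, x)) (by fun_prop)
  convert hasDerivAt_integral_of_contDiff (g := fun s x => ∑ i, F s x i ^ 2) hK
    ((ContDiff.sum fun i _ => (hF' i).pow 2).of_le (by exact_mod_cast le_top))
    (fun s x hx => by simp [h s x hx]) t using 3 with x
  have := HasDerivAt.fun_sum (u := Finset.univ) fun i _ => ((hd x i t).hasDerivAt.pow 2)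
  rw [HasDerivAt.deriv (by simpa using this), Finset.mul_sum]
  refine Finset.sum_congr rfl fun i _ => ?_
  ring

/-- Integrability of `F · ∂ₜF`. -/
lemma integrable_sum_mul_deriv {F : ℝ → (Fin 3 → ℝ) → (Fin 3 → ℝ)} {K : Set (Fin 3 → ℝ)}
    (hK : IsCompact K) (hF : ContDiff ℝ (⊤ : ℕ∞) (fun q : ℝ × (Fin 3 → ℝ) => F q.1 q.2))
    (h : ∀ t, ∀ x ∉ K, F t x = 0) (t : ℝ) :
    Integrable fun x => ∑ i, F t x i * deriv (fun s => F s x i) t := by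
  have hF' : ∀ i, ContDiff ℝ (⊤ : ℕ∞) (fun q : ℝ × (Fin 3 → ℝ) => F q.1 q.2 i) :=
    contDiff_pi.1 hF
  refine Continuous.integrable_of_eq_zero (K := K) (continuous_finsetSum _ fun i _ => ?_) hK
    fun x hx => by simp [h t x hx]
  have hder : ∀ x, deriv (fun s => F s x i) t
      = fderiv ℝ (fun q : ℝ × (Fin 3 → ℝ) => F q.1 q.2 i) (t, x) (1, 0) := fun x => by
    have h1 := ((hF' i).differentiable (by simp) (t, x)).hasFDerivAt
    have h2 : HasDerivAt (fun s : ℝ => (s, x)) ((1 : ℝ), (0 : Fin 3 → ℝ)) t :=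
      (hasDerivAt_id t).prodMk (hasDerivAt_const t x)
    exact (h1.comp_hasDerivAt t h2).deriv
  have hx : Continuous fun x : Fin 3 → ℝ => (t, x) := by fun_prop
  simp only [hder]
  exact ((hF' i).continuous.comp hx).mul
    ((((hF' i).continuous_fderiv (by simp)).clm_apply continuous_const).comp hx)

/-- Energy identity for smooth, spatially compactly supported solutions of the
incompressible MHD system:
`d/dt[(μ/2)‖H‖² + (1/2)‖u‖²] + σ⁻¹‖∇×H‖² + ν‖∇u‖² = σ⁻¹(J, ∇×H) + (f, u)`. -/
theorem mhd_energy_identity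
    (T μ σ ν : ℝ) (hT : 0 < T) (hμ : 0 < μ) (hσ : 0 < σ) (hν : 0 < ν)
    (K : Set (Fin 3 → ℝ)) (hK : IsCompact K)
    (H u J f : ℝ → (Fin 3 → ℝ) → (Fin 3 → ℝ)) (p : ℝ → (Fin 3 → ℝ) → ℝ)
    (hH : ContDiff ℝ (⊤ : ℕ∞) (fun q : ℝ × (Fin 3 → ℝ) => H q.1 q.2))
    (hu : ContDiff ℝ (⊤ : ℕ∞) (fun q : ℝ × (Fin 3 → ℝ) => u q.1 q.2))
    (hJ : ContDiff ℝ (⊤ : ℕ∞) (fun q : ℝ × (Fin 3 → ℝ) => J q.1 q.2))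
    (hf : ContDiff ℝ (⊤ : ℕ∞) (fun q : ℝ × (Fin 3 → ℝ) => f q.1 q.2))
    (hp : ContDiff ℝ (⊤ : ℕ∞) (fun q : ℝ × (Fin 3 → ℝ) => p q.1 q.2))
    (hsuppH : ∀ t, ∀ x ∉ K, H t x = 0)
    (hsuppu : ∀ t, ∀ x ∉ K, u t x = 0)
    (hsuppJ : ∀ t, ∀ x ∉ K, J t x = 0)
    (hsuppf : ∀ t, ∀ x ∉ K, f t x = 0)
    (hsuppp : ∀ t, ∀ x ∉ K, p t x = 0)
    (heqH : ∀ t ∈ Set.Icc (0 : ℝ) T, ∀ x : Fin 3 → ℝ, ∀ i : Fin 3,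
      μ * deriv (fun s => H s x i) t
        + σ⁻¹ * curl3 (fun y => curl3 (H t) y) x i
        - μ * curl3 (fun y => cross3 (u t y) (H t y)) x i
        = σ⁻¹ * curl3 (J t) x i)
    (hequ : ∀ t ∈ Set.Icc (0 : ℝ) T, ∀ x : Fin 3 → ℝ, ∀ i : Fin 3,
      deriv (fun s => u s x i) t
        + (∑ j, u t x j * pd3 (u t) j x i)
        - ν * lap3 (u t) x i
        + pds3 (p t) i x
        = f t x i - μ * cross3 (H t x) (curl3 (H t) x) i)
    (hdiv : ∀ t ∈ Set.Icc (0 : ℝ) T, ∀ x : Fin 3 → ℝ, div3 (u t) x = 0) :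
    ∀ t ∈ Set.Icc (0 : ℝ) T,
      HasDerivWithinAt
        (fun s => (μ / 2) * (∫ x, ∑ i, H s x i ^ 2)
          + (1 / 2) * (∫ x, ∑ i, u s x i ^ 2))
        ((σ⁻¹ * ∫ x, ∑ i, J t x i * curl3 (H t) x i)
          + (∫ x, ∑ i, f t x i * u t x i)
          - σ⁻¹ * (∫ x, ∑ i, curl3 (H t) x i ^ 2)
          - ν * (∫ x, ∑ i, ∑ j, pd3 (u t) j x i ^ 2))
        (Set.Icc (0 : ℝ) T) t := by
  intro t ht
  have slice : ∀ {F : ℝ → (Fin 3 → ℝ) → (Fin 3 → ℝ)},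
      ContDiff ℝ (⊤ : ℕ∞) (fun q : ℝ × (Fin 3 → ℝ) => F q.1 q.2) →
      ContDiff ℝ (⊤ : ℕ∞) (F t) := fun hF => hF.comp (contDiff_const.prodMk contDiff_id)
  have cH := slice hH
  have cu := slice hu
  have cJ := slice hJ
  have cf := slice hf
  have cp : ContDiff ℝ (⊤ : ℕ∞) (p t) := hp.comp (contDiff_const.prodMk contDiff_id)
  have ccH := contDiff_curl3 cH
  have cuH := contDiff_cross3 cu cH
  have cc : ∀ {F : (Fin 3 → ℝ) → (Fin 3 → ℝ)}, ContDiff ℝ (⊤ : ℕ∞) F →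
      ∀ i, ContDiff ℝ (⊤ : ℕ∞) (fun y => F y i) := fun hF => contDiff_pi.1 hF
  have one_le : (1 : WithTop ℕ∞) ≤ ((⊤ : ℕ∞) : WithTop ℕ∞) := by exact_mod_cast le_top
  have dd : ∀ {F : (Fin 3 → ℝ) → (Fin 3 → ℝ)}, ContDiff ℝ (⊤ : ℕ∞) F →
      Differentiable ℝ F := fun hF => hF.differentiable (by simp)
  have csq : ContDiff ℝ (⊤ : ℕ∞) fun y => ∑ i, u t y i ^ 2 :=
    ContDiff.sum fun i _ => (cc cu i).pow 2
  have crossH : ∀ {G : (Fin 3 → ℝ) → (Fin 3 → ℝ)}, ContDiff ℝ (⊤ : ℕ∞) G →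
      Integrable (div3 fun y => cross3 (H t y) (G y)) ∧
        ∫ x, div3 (fun y => cross3 (H t y) (G y)) x = 0 := fun {G} hG => by
    have h0 : ∀ y ∉ K, cross3 (H t y) (G y) = 0 := fun y hy => by
      funext i
      fin_cases i <;> simp [cross3, hsuppH t y hy]
    have h1 := (contDiff_cross3 cH hG).of_le one_le
    exact ⟨integrable_div3 hK h1 h0, integral_div3 hK h1 h0⟩
  obtain ⟨i1, z1⟩ := crossH ccH
  obtain ⟨i2, z2⟩ := crossH cuH
  obtain ⟨i3, z3⟩ := crossH cJ
  have mulu : ∀ {a : (Fin 3 → ℝ) → ℝ}, ContDiff ℝ (⊤ : ℕ∞) a →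
      Integrable (div3 fun y i => a y * u t y i) ∧
        ∫ x, div3 (fun y i => a y * u t y i) x = 0 := fun {a} ha => by
    have h0 : ∀ y ∉ K, (fun i => a y * u t y i) = 0 := fun y hy => by
      funext i
      simp [hsuppu t y hy]
    have h1 := (contDiff_pi.2 fun i => ha.mul (cc cu i)).of_le one_le
    exact ⟨integrable_div3 hK h1 h0, integral_div3 hK h1 h0⟩
  obtain ⟨i4, z4⟩ := mulu csq
  obtain ⟨i5, z5⟩ := mulu cp
  have c6 := (contDiff_pi.2 fun j => ContDiff.sum (s := Finset.univ) fun i _ =>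
    (cc cu i).mul (cc (contDiff_pd3 cu j) i)).of_le one_le
  have h6 : ∀ y ∉ K, (fun j => ∑ i, u t y i * pd3 (u t) j y i) = 0 := fun y hy => by
    funext j
    simp [hsuppu t y hy]
  have i6 := integrable_div3 hK c6 h6
  have z6 := integral_div3 hK c6 h6
  have r1 : Integrable fun x => ∑ i, J t x i * curl3 (H t) x i :=
    (ContDiff.sum fun i _ => (cc cJ i).mul (cc ccH i)).continuous.integrable_of_eq_zero hK
      fun x hx => by simp [hsuppJ t x hx]
  have r2 : Integrable fun x => ∑ i, f t x i * u t x i :=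
    (ContDiff.sum fun i _ => (cc cf i).mul (cc cu i)).continuous.integrable_of_eq_zero hK
      fun x hx => by simp [hsuppu t x hx]
  have r3 : Integrable fun x => ∑ i, curl3 (H t) x i ^ 2 :=
    (ContDiff.sum fun i _ => (cc ccH i).pow 2).continuous.integrable_of_eq_zero hK
      fun x hx => by simp [curl3_eq_zero hK.isClosed (hsuppH t) hx]
  have r4 : Integrable fun x => ∑ i, ∑ j, pd3 (u t) j x i ^ 2 :=
    (ContDiff.sum fun i _ => ContDiff.sum fun j _ =>
      (cc (contDiff_pd3 cu j) i).pow 2).continuous.integrable_of_eq_zero hK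
      fun x hx => by simp [pd3_eq_zero hK.isClosed (hsuppu t) _ hx]
  have key : ∀ x, μ * (∑ i, H t x i * deriv (fun s => H s x i) t)
      + ∑ i, u t x i * deriv (fun s => u s x i) t
      = σ⁻¹ * (∑ i, J t x i * curl3 (H t) x i) + (∑ i, f t x i * u t x i)
        - σ⁻¹ * (∑ i, curl3 (H t) x i ^ 2) - ν * (∑ i, ∑ j, pd3 (u t) j x i ^ 2)
        + σ⁻¹ * div3 (fun y => cross3 (H t y) (curl3 (H t) y)) x
        - μ * div3 (fun y => cross3 (H t y) (cross3 (u t y) (H t y))) x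
        - σ⁻¹ * div3 (fun y => cross3 (H t y) (J t y)) x
        - (1 / 2) * div3 (fun y i => (∑ i, u t y i ^ 2) * u t y i) x
        - div3 (fun y i => p t y * u t y i) x
        + ν * div3 (fun y j => ∑ i, u t y i * pd3 (u t) j y i) x := fun x => by
    rw [div3_cross3 (dd cH) (dd ccH), div3_cross3 (dd cH) (dd cuH), div3_cross3 (dd cH) (dd cJ),
      div3_mul (csq.differentiable (by simp)) (dd cu), div3_mul (cp.differentiable (by simp)) (dd cu),
      div3_sum_mul_pd3 cu, hdiv t ht x]
    simp only [pds3_sum_sq (dd cu)]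
    have eH := heqH t ht x
    have eu := hequ t ht x
    generalize curl3 (fun y => curl3 (H t) y) x = A at *
    generalize curl3 (fun y => cross3 (u t y) (H t y)) x = B at *
    generalize curl3 (J t) x = C at *
    generalize curl3 (H t) x = D at *
    generalize lap3 (u t) x = L at *
    simp only [Fin.sum_univ_three, cross3, Matrix.cons_val] at *
    have e0 := eu 0
    have e1 := eu 1
    have e2 := eu 2
    simp only [Matrix.cons_val] at e0 e1 e2
    linear_combination H t x 0 * eH 0 + H t x 1 * eH 1 + H t x 2 * eH 2
      + u t x 0 * e0 + u t x 1 * e1 + u t x 2 * e2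
  have hint := integral_congr_ae (μ := volume) (Filter.Eventually.of_forall key)
  have tH := integrable_sum_mul_deriv hK hH hsuppH t
  have tu := integrable_sum_mul_deriv hK hu hsuppu t
  have s1 := (r1.const_mul σ⁻¹).add r2
  have s2 := s1.sub (r3.const_mul σ⁻¹)
  have s3 := s2.sub (r4.const_mul ν)
  have s4 := s3.add (i1.const_mul σ⁻¹)
  have s5 := s4.sub (i2.const_mul μ)
  have s6 := s5.sub (i3.const_mul σ⁻¹)
  have s7 := s6.sub (i4.const_mul (1 / 2))
  have s8 := s7.sub i5
  rw [integral_add (tH.const_mul μ) tu] at hint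
  erw [integral_add s8 (i6.const_mul ν), integral_sub s7 i5, integral_sub s6 (i4.const_mul (1 / 2)),
    integral_sub s5 (i3.const_mul σ⁻¹), integral_sub s4 (i2.const_mul μ),
    integral_add s3 (i1.const_mul σ⁻¹), integral_sub s2 (r4.const_mul ν),
    integral_sub s1 (r3.const_mul σ⁻¹), integral_add (r1.const_mul σ⁻¹) r2] at hint
  simp only [integral_const_mul, z1, z2, z3, z4, z5, z6] at hint
  have hfin := ((hasDerivAt_integral_sum_sq hK hH hsuppH t).const_mul (μ / 2)).add
    ((hasDerivAt_integral_sum_sq hK hu hsuppu t).const_mul (1 / 2))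
  refine (hfin.congr_deriv ?_).hasDerivWithinAt
  simp only [integral_const_mul]
  linear_combination hint
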